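/- Let ρ > 0 and k ∈ (0,1). Suppose γ^r ∈ (0,1) is such that some stationary distributions π_r (full flexibility) and p_r (partial flexibility) with parameters (ρ, k, γ^r) satisfy T_fs(π_r) = T_ps(p_r). Then for every γ with γ^r < γ < 1, and for any stationary distributions π (full flexibility) and p (partial flexibility) with parameters (ρ, k, γ), one has T_is < T_ps(p) < T_fs(π), where T_is = ρ/(ρ+1) + kρ/(kρ+1). (In particular, the full flexibility system is optimal for γ ∈ (γ^r, 1).) -/

import Mathlib

/-- The balance equations of the full flexibility system with parameters `ρ`, `k`, `γ`. -/
def FullBalance (ρ k γ : ℝ) (π : Fin 3 → Fin 3 → ℝ) : Prop :=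
  (ρ + k*ρ) * π 0 0 = π 1 0 + γ * π 0 1 + π 0 2 + γ * π 2 0 ∧
  (ρ + k*ρ + 1) * π 1 0 = ρ * π 0 0 + γ * π 1 1 + π 1 2 ∧
  (ρ + k*ρ + γ) * π 2 0 = γ * π 2 1 + π 2 2 ∧
  (ρ + k*ρ + γ) * π 0 1 = π 1 1 + γ * π 2 1 ∧
  (1 + γ) * π 1 1 = ρ * π 1 0 + ρ * π 0 1 ∧
  2 * γ * π 2 1 = ρ * π 2 0 + k*ρ * π 0 1 ∧
  (ρ + k*ρ + 1) * π 0 2 = k*ρ * π 0 0 + π 1 2 + γ * π 2 2 ∧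
  2 * π 1 2 = ρ * π 0 2 + k*ρ * π 1 0 ∧
  (γ + 1) * π 2 2 = k*ρ * π 2 0 + k*ρ * π 0 2

/-- `π` is a stationary distribution of the full flexibility system. -/
def FullStationary (ρ k γ : ℝ) (π : Fin 3 → Fin 3 → ℝ) : Prop :=
  (∀ i j, 0 ≤ π i j) ∧ (∑ i : Fin 3, ∑ j : Fin 3, π i j) = 1 ∧ FullBalance ρ k γ π

/-- Throughput of the full flexibility system. -/
noncomputable def Tfs (ρ k : ℝ) (π : Fin 3 → Fin 3 → ℝ) : ℝ :=
  (k + 1) * ρ * (1 - π 1 1 - π 1 2 - π 2 1 - π 2 2)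

/-- The balance equations of the partial flexibility system with parameters `ρ`, `k`, `γ`. -/
def PartialBalance (ρ k γ : ℝ) (p : Fin 2 → Fin 3 → ℝ) : Prop :=
  (ρ + k*ρ) * p 0 0 = p 1 0 + γ * p 0 1 + p 0 2 ∧
  (ρ + k*ρ + 1) * p 1 0 = ρ * p 0 0 + γ * p 1 1 + p 1 2 ∧
  2 * p 1 2 = ρ * p 0 2 + k*ρ * p 1 0 ∧
  (ρ + 1) * p 0 2 = k*ρ * p 0 0 + p 1 2 ∧
  (1 + γ) * p 1 1 = ρ * (p 0 1 + p 1 0) ∧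
  (ρ + γ) * p 0 1 = p 1 1

/-- `p` is a stationary distribution of the partial flexibility system. -/
def PartialStationary (ρ k γ : ℝ) (p : Fin 2 → Fin 3 → ℝ) : Prop :=
  (∀ m n, 0 ≤ p m n) ∧ (∑ m : Fin 2, ∑ n : Fin 3, p m n) = 1 ∧ PartialBalance ρ k γ p

/-- Throughput of the partial flexibility system. -/
noncomputable def Tps (ρ k : ℝ) (p : Fin 2 → Fin 3 → ℝ) : ℝ :=
  ρ * (1 - p 1 1 - p 1 2) + k*ρ * (1 - p 1 1 - p 1 2 - p 0 1 - p 0 2)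

/-- Throughput of the independent system. -/
noncomputable def Tis (ρ k : ℝ) : ℝ := ρ/(ρ+1) + k*ρ/(k*ρ+1)

/-- Stationary weight of the empty state of the full flexibility system with arrival rates `a`, `b`. -/
def idleWeight (a b g : ℝ) : ℝ :=
  2 * a ^ 3 * g ^ 2 + 2 * a ^ 3 * g + 6 * a ^ 2 * b * g ^ 2 + 6 * a ^ 2 * b * g + 5 * a ^ 2 * g ^
    3 + 10 * a ^ 2 * g ^ 2 + 5 * a ^ 2 * g + 6 * a * b ^ 2 * g ^ 2 + 6 * a * b ^ 2 * g + 6 * a * b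
    * g ^ 3 + 28 * a * b * g ^ 2 + 6 * a * b * g + 2 * a * g ^ 4 + 14 * a * g ^ 3 + 14 * a * g ^ 2
    + 2 * a * g + 2 * b ^ 3 * g ^ 2 + 2 * b ^ 3 * g + 5 * b ^ 2 * g ^ 3 + 10 * b ^ 2 * g ^ 2 + 5 *
    b ^ 2 * g + 2 * b * g ^ 4 + 14 * b * g ^ 3 + 14 * b * g ^ 2 + 2 * b * g + 4 * g ^ 4 + 8 * g ^
    3 + 4 * g ^ 2

/-- Stationary weight of the state where only a first-type customer is present, served by the
non-dedicated server. -/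
def overflowWeight (a b g : ℝ) : ℝ :=
  a ^ 4 * g + a ^ 4 + 3 * a ^ 3 * b * g + 3 * a ^ 3 * b + 2 * a ^ 3 * g ^ 2 + 4 * a ^ 3 * g + 2 *
    a ^ 3 + 3 * a ^ 2 * b ^ 2 * g + 3 * a ^ 2 * b ^ 2 + 2 * a ^ 2 * b * g ^ 2 + 10 * a ^ 2 * b * g
    + 4 * a ^ 2 * g ^ 2 + 4 * a ^ 2 * g + a * b ^ 3 * g + a * b ^ 3 + 2 * a * b ^ 2 * g + 2 * a *
    b ^ 2

/-- Stationary weight of the state where only a first-type customer is present, served by the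
dedicated server. -/
def dedicatedWeight (a b g : ℝ) : ℝ :=
  a ^ 4 * g ^ 2 + a ^ 4 * g + 3 * a ^ 3 * b * g ^ 2 + 3 * a ^ 3 * b * g + 3 * a ^ 3 * g ^ 3 + 6 *
    a ^ 3 * g ^ 2 + 3 * a ^ 3 * g + 3 * a ^ 2 * b ^ 2 * g ^ 2 + 3 * a ^ 2 * b ^ 2 * g + 6 * a ^ 2
    * b * g ^ 3 + 18 * a ^ 2 * b * g ^ 2 + 4 * a ^ 2 * b * g + 2 * a ^ 2 * g ^ 4 + 10 * a ^ 2 * g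
    ^ 3 + 10 * a ^ 2 * g ^ 2 + 2 * a ^ 2 * g + a * b ^ 3 * g ^ 2 + a * b ^ 3 * g + 3 * a * b ^ 2 *
    g ^ 3 + 8 * a * b ^ 2 * g ^ 2 + 5 * a * b ^ 2 * g + 2 * a * b * g ^ 4 + 14 * a * b * g ^ 3 +
    14 * a * b * g ^ 2 + 2 * a * b * g + 4 * a * g ^ 4 + 8 * a * g ^ 3 + 4 * a * g ^ 2

/-- Total stationary weight of the non-blocking states. -/
def freeWeight (a b g : ℝ) : ℝ :=
  idleWeight a b g + overflowWeight a b g + overflowWeight b a g + dedicatedWeight a b g +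
    dedicatedWeight b a g

/-- Total stationary weight of the blocking states, scaled by `2 * g * (1 + g)`. -/
def blockedWeight (a b g : ℝ) : ℝ :=
  2 * g * a * (dedicatedWeight a b g + overflowWeight a b g) +
    (1 + g) * (a * overflowWeight b a g + b * overflowWeight a b g) +
    g * (1 + g) * (a * dedicatedWeight b a g + b * dedicatedWeight a b g) +
    2 * g * b * (overflowWeight b a g + dedicatedWeight b a g)

/-- Normalization of the stationary weights of the partial flexibility system. -/
def partialNorm (a b g : ℝ) : ℝ :=
  a ^ 4 + a ^ 3 * b * g + a ^ 3 * b + 2 * a ^ 3 * g + 3 * a ^ 3 + a ^ 2 * b ^ 2 * g + a ^ 2 * b *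
    g ^ 2 + 7 * a ^ 2 * b * g + a ^ 2 * b + a ^ 2 * g ^ 2 + 7 * a ^ 2 * g + 2 * a ^ 2 + a * b ^ 2
    * g ^ 2 + 2 * a * b ^ 2 * g + 4 * a * b * g ^ 2 + 9 * a * b * g + 3 * a * g ^ 2 + 7 * a * g +
    b ^ 2 * g ^ 2 + b ^ 2 * g + 3 * b * g ^ 2 + 3 * b * g + 2 * g ^ 2 + 2 * g

/-- Unnormalized throughput of the partial flexibility system. -/
def partialRate (a b g : ℝ) : ℝ :=
  a ^ 4 * g + a ^ 4 + 3 * a ^ 3 * b * g + a ^ 3 * b + a ^ 3 * g ^ 2 + 5 * a ^ 3 * g + 2 * a ^ 3 +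
    2 * a ^ 2 * b ^ 2 * g + 3 * a ^ 2 * b * g ^ 2 + 12 * a ^ 2 * b * g + 3 * a ^ 2 * g ^ 2 + 7 * a
    ^ 2 * g + 2 * a * b ^ 2 * g ^ 2 + 3 * a * b ^ 2 * g + 6 * a * b * g ^ 2 + 10 * a * b * g + 2 *
    a * g ^ 2 + 2 * a * g + b ^ 2 * g ^ 2 + b ^ 2 * g + 2 * b * g ^ 2 + 2 * b * g

/-- Up to sign, the coefficient of degree 0 of `crossingPoly`. -/
def crossingCoeffZero (a b : ℝ) : ℝ :=
  a ^ 8 + 4 * a ^ 7 * b + 4 * a ^ 7 + 6 * a ^ 6 * b ^ 2 + 8 * a ^ 6 * b + 4 * a ^ 6 + 4 * a ^ 5 *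
    b ^ 3 + 8 * a ^ 5 * b ^ 2 + a ^ 4 * b ^ 4 + 4 * a ^ 4 * b ^ 3 + 4 * a ^ 4 * b ^ 2

/-- Up to sign, the coefficient of degree 1 of `crossingPoly`. -/
def crossingCoeffOne (a b : ℝ) : ℝ :=
  2 * a ^ 7 * b + 3 * a ^ 7 + 8 * a ^ 6 * b ^ 2 + 31 * a ^ 6 * b + 13 * a ^ 6 + 12 * a ^ 5 * b ^ 3
    + 53 * a ^ 5 * b ^ 2 + 67 * a ^ 5 * b + 16 * a ^ 5 + 8 * a ^ 4 * b ^ 4 + 43 * a ^ 4 * b ^ 3 +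
    52 * a ^ 4 * b ^ 2 + 28 * a ^ 4 * b + 4 * a ^ 4 + 2 * a ^ 3 * b ^ 5 + 20 * a ^ 3 * b ^ 4 + 52
    * a ^ 3 * b ^ 3 + 24 * a ^ 3 * b ^ 2 + 4 * a ^ 3 * b + 2 * a ^ 2 * b ^ 5 + 15 * a ^ 2 * b ^ 4
    + 24 * a ^ 2 * b ^ 3 + 4 * a ^ 2 * b ^ 2 + a * b ^ 5 + 4 * a * b ^ 4 + 4 * a * b ^ 3

/-- Up to sign, the coefficient of degree 2 of `crossingPoly`. -/
def crossingCoeffTwo (a b : ℝ) : ℝ :=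
  a ^ 8 + 4 * a ^ 7 * b + 5 * a ^ 7 + 5 * a ^ 6 * b ^ 2 + 15 * a ^ 6 * b + 9 * a ^ 6 - 17 * a ^ 5
    * b ^ 2 - 10 * a ^ 5 * b + 8 * a ^ 5 - 5 * a ^ 4 * b ^ 4 - 44 * a ^ 4 * b ^ 3 - 134 * a ^ 4 *
    b ^ 2 - 67 * a ^ 4 * b + 4 * a ^ 4 - 4 * a ^ 3 * b ^ 5 - 27 * a ^ 3 * b ^ 4 - 68 * a ^ 3 * b ^
    3 - 119 * a ^ 3 * b ^ 2 - 40 * a ^ 3 * b - a ^ 2 * b ^ 6 - 11 * a ^ 2 * b ^ 5 - 31 * a ^ 2 * b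
    ^ 4 - 41 * a ^ 2 * b ^ 3 - 32 * a ^ 2 * b ^ 2 - 4 * a ^ 2 * b - a * b ^ 6 - 6 * a * b ^ 5 - 13
    * a * b ^ 4 - 12 * a * b ^ 3 - 4 * a * b ^ 2

/-- Up to sign, the coefficient of degree 3 of `crossingPoly`. -/
def crossingCoeffThree (a b : ℝ) : ℝ :=
  2 * a ^ 7 * b + 4 * a ^ 7 + 8 * a ^ 6 * b ^ 2 + 29 * a ^ 6 * b + 22 * a ^ 6 + 12 * a ^ 5 * b ^ 3
    + 72 * a ^ 5 * b ^ 2 + 101 * a ^ 5 * b + 46 * a ^ 5 + 8 * a ^ 4 * b ^ 4 + 58 * a ^ 4 * b ^ 3 +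
    168 * a ^ 4 * b ^ 2 + 160 * a ^ 4 * b + 50 * a ^ 4 + 2 * a ^ 3 * b ^ 5 + 12 * a ^ 3 * b ^ 4 +
    41 * a ^ 3 * b ^ 3 + 124 * a ^ 3 * b ^ 2 + 137 * a ^ 3 * b + 32 * a ^ 3 + a ^ 2 * b ^ 5 + 13 *
    a ^ 2 * b ^ 4 + 26 * a ^ 2 * b ^ 3 + 41 * a ^ 2 * b ^ 2 + 52 * a ^ 2 * b + 8 * a ^ 2 + 6 * a *
    b ^ 5 + 22 * a * b ^ 4 + 23 * a * b ^ 3 + 8 * a * b ^ 2 + 4 * a * b + b ^ 6 + 6 * b ^ 5 + 13 *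
    b ^ 4 + 12 * b ^ 3 + 4 * b ^ 2

/-- Up to sign, the coefficient of degree 4 of `crossingPoly`. -/
def crossingCoeffFour (a b : ℝ) : ℝ :=
  a ^ 6 * b ^ 2 + 7 * a ^ 6 * b + 4 * a ^ 6 + 4 * a ^ 5 * b ^ 3 + 32 * a ^ 5 * b ^ 2 + 63 * a ^ 5
    * b + 24 * a ^ 5 + 6 * a ^ 4 * b ^ 4 + 60 * a ^ 4 * b ^ 3 + 173 * a ^ 4 * b ^ 2 + 176 * a ^ 4
    * b + 52 * a ^ 4 + 4 * a ^ 3 * b ^ 5 + 50 * a ^ 3 * b ^ 4 + 205 * a ^ 3 * b ^ 3 + 351 * a ^ 3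
    * b ^ 2 + 235 * a ^ 3 * b + 48 * a ^ 3 + a ^ 2 * b ^ 6 + 17 * a ^ 2 * b ^ 5 + 97 * a ^ 2 * b ^
    4 + 269 * a ^ 2 * b ^ 3 + 337 * a ^ 2 * b ^ 2 + 166 * a ^ 2 * b + 16 * a ^ 2 + 2 * a * b ^ 6 +
    24 * a * b ^ 5 + 101 * a * b ^ 4 + 189 * a * b ^ 3 + 160 * a * b ^ 2 + 52 * a * b + 2 * b ^ 6
    + 15 * b ^ 5 + 43 * b ^ 4 + 58 * b ^ 3 + 36 * b ^ 2 + 8 * b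

/-- Up to sign, the coefficient of degree 5 of `crossingPoly`. -/
def crossingCoeffFive (a b : ℝ) : ℝ :=
  4 * a ^ 5 * b ^ 2 + 11 * a ^ 5 * b + 2 * a ^ 5 + 13 * a ^ 4 * b ^ 3 + 60 * a ^ 4 * b ^ 2 + 72 *
    a ^ 4 * b + 10 * a ^ 4 + 15 * a ^ 3 * b ^ 4 + 105 * a ^ 3 * b ^ 3 + 228 * a ^ 3 * b ^ 2 + 165
    * a ^ 3 * b + 16 * a ^ 3 + 7 * a ^ 2 * b ^ 5 + 71 * a ^ 2 * b ^ 4 + 252 * a ^ 2 * b ^ 3 + 365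
    * a ^ 2 * b ^ 2 + 186 * a ^ 2 * b + 8 * a ^ 2 + a * b ^ 6 + 16 * a * b ^ 5 + 98 * a * b ^ 4 +
    251 * a * b ^ 3 + 276 * a * b ^ 2 + 108 * a * b + b ^ 6 + 12 * b ^ 5 + 49 * b ^ 4 + 90 * b ^ 3
    + 76 * b ^ 2 + 24 * b

/-- Up to sign, the coefficient of degree 6 of `crossingPoly`. -/
def crossingCoeffSix (a b : ℝ) : ℝ :=
  5 * a ^ 4 * b ^ 2 + 7 * a ^ 4 * b + 13 * a ^ 3 * b ^ 3 + 50 * a ^ 3 * b ^ 2 + 41 * a ^ 3 * b +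
    11 * a ^ 2 * b ^ 4 + 70 * a ^ 2 * b ^ 3 + 143 * a ^ 2 * b ^ 2 + 86 * a ^ 2 * b + 3 * a * b ^ 5
    + 30 * a * b ^ 4 + 107 * a * b ^ 3 + 156 * a * b ^ 2 + 76 * a * b + 3 * b ^ 5 + 21 * b ^ 4 +
    54 * b ^ 3 + 60 * b ^ 2 + 24 * b

/-- Up to sign, the coefficient of degree 7 of `crossingPoly`. -/
def crossingCoeffSeven (a b : ℝ) : ℝ :=
  2 * a ^ 3 * b ^ 2 + 2 * a ^ 3 * b + 4 * a ^ 2 * b ^ 3 + 14 * a ^ 2 * b ^ 2 + 10 * a ^ 2 * b + 2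
    * a * b ^ 4 + 14 * a * b ^ 3 + 28 * a * b ^ 2 + 16 * a * b + 2 * b ^ 4 + 10 * b ^ 3 + 16 * b ^
    2 + 8 * b

/-- A polynomial with the sign of the difference between the throughputs of the full and of the
partial flexibility systems. -/
def crossingPoly (a b g : ℝ) : ℝ :=
  -crossingCoeffZero a b - crossingCoeffOne a b * g + crossingCoeffTwo a b * g ^ 2 +
    crossingCoeffThree a b * g ^ 3 + crossingCoeffFour a b * g ^ 4 +
    crossingCoeffFive a b * g ^ 5 + crossingCoeffSix a b * g ^ 6 +
    crossingCoeffSeven a b * g ^ 7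

section Weights

variable {a b g : ℝ}

lemma idleWeight_pos (ha : 0 < a) (hb : 0 < b) (hg : 0 < g) : 0 < idleWeight a b g := by
  unfold idleWeight; positivity

lemma overflowWeight_pos (ha : 0 < a) (hb : 0 < b) (hg : 0 < g) : 0 < overflowWeight a b g := by
  unfold overflowWeight; positivity

lemma dedicatedWeight_pos (ha : 0 < a) (hb : 0 < b) (hg : 0 < g) :
    0 < dedicatedWeight a b g := by
  unfold dedicatedWeight; positivity

lemma partialNorm_pos (ha : 0 < a) (hb : 0 < b) (hg : 0 < g) : 0 < partialNorm a b g := by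
  unfold partialNorm; positivity

lemma idleWeight_comm (a b g : ℝ) : idleWeight b a g = idleWeight a b g := by
  unfold idleWeight; ring

lemma fullNorm_pos (ha : 0 < a) (hb : 0 < b) (hg : 0 < g) :
    0 < 2 * g * (1 + g) * freeWeight a b g + blockedWeight a b g := by
  have := idleWeight_pos ha hb hg
  have := overflowWeight_pos ha hb hg
  have := overflowWeight_pos hb ha hg
  have := dedicatedWeight_pos ha hb hg
  have := dedicatedWeight_pos hb ha hg
  unfold freeWeight blockedWeight
  positivity

end Weights

/-- The balance equations of the states with at most one customer determine the weights of the
states with a single first-type customer. -/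
lemma singleton_weights {a b g x y u v z : ℝ} (hg : 0 < g)
    (h1 : 2 * (1 + g) * (a + b + g) * x = (1 + g) * (a * x + b * y) + 2 * b * (x + v))
    (h2 : 2 * (1 + g) * (a + b + g) * y = 2 * a * (u + y) + (1 + g) * (a * x + b * y))
    (h3 : 2 * (1 + g) * (a + b + 1) * u =
      2 * (1 + g) * a * z + 2 * g * a * (u + y) + (1 + g) * (a * v + b * u))
    (h4 : 2 * (1 + g) * (a + b + 1) * v =
      2 * (1 + g) * b * z + (1 + g) * (a * v + b * u) + 2 * g * b * (x + v)) :
    idleWeight a b g * y = z * overflowWeight a b g ∧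
      idleWeight a b g * u = z * dedicatedWeight a b g := by
  have hc : 2 * (1 + g) ≠ 0 := by positivity
  unfold idleWeight overflowWeight dedicatedWeight
  constructor
  · apply mul_left_cancel₀ hc
    linear_combination
      (a ^ 3 * g + a ^ 3 + 2 * a ^ 2 * b * g + 2 * a ^ 2 * b + a ^ 2 * g ^ 2 + 4 * a ^ 2 * g + 3
          * a ^ 2 + a * b ^ 2 * g + a * b ^ 2 + a * b * g ^ 2 + 4 * a * b * g + 3 * a * b + 2 * a
          * g ^ 2 + 4 * a * g + 2 * a) * h1 +
      (a ^ 3 * g + a ^ 3 + 2 * a ^ 2 * b * g + 2 * a ^ 2 * b + 3 * a ^ 2 * g ^ 2 + 6 * a ^ 2 * g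
          + 3 * a ^ 2 + a * b ^ 2 * g + a * b ^ 2 + 3 * a * b * g ^ 2 + 14 * a * b * g + 3 * a * b
          + 2 * a * g ^ 3 + 10 * a * g ^ 2 + 10 * a * g + 2 * a + 4 * b ^ 2 * g ^ 2 + 4 * b ^ 2 *
          g + 2 * b * g ^ 3 + 12 * b * g ^ 2 + 10 * b * g + 4 * g ^ 3 + 8 * g ^ 2 + 4 * g) * h2 +
      (a ^ 3 * g + a ^ 3 + 2 * a ^ 2 * b * g + 2 * a ^ 2 * b + 2 * a ^ 2 * g ^ 2 + 4 * a ^ 2 * g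
          + 2 * a ^ 2 + a * b ^ 2 * g + a * b ^ 2 + 8 * a * b * g + 4 * a * g ^ 2 + 4 * a * g) * h3 +
      (a ^ 3 * g + a ^ 3 + 2 * a ^ 2 * b * g + 2 * a ^ 2 * b + 2 * a ^ 2 * g ^ 2 + 2 * a ^ 2 * g
          + a * b ^ 2 * g + a * b ^ 2 + 2 * a * b * g + 2 * a * b) * h4
  · apply mul_left_cancel₀ hc
    linear_combination
      (a ^ 3 * g ^ 2 + a ^ 3 * g + 2 * a ^ 2 * b * g ^ 2 + 2 * a ^ 2 * b * g + 2 * a ^ 2 * g ^ 2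
          + 2 * a ^ 2 * g + a * b ^ 2 * g ^ 2 + a * b ^ 2 * g + 2 * a * b * g ^ 3 + 2 * a * b * g
          ^ 2) * h1 +
      (a ^ 3 * g ^ 2 + a ^ 3 * g + 2 * a ^ 2 * b * g ^ 2 + 2 * a ^ 2 * b * g + 2 * a ^ 2 * g ^ 3
          + 4 * a ^ 2 * g ^ 2 + 2 * a ^ 2 * g + a * b ^ 2 * g ^ 2 + a * b ^ 2 * g + 8 * a * b * g
          ^ 2 + 4 * a * g ^ 3 + 4 * a * g ^ 2) * h2 +
      (a ^ 3 * g ^ 2 + a ^ 3 * g + 2 * a ^ 2 * b * g ^ 2 + 2 * a ^ 2 * b * g + 3 * a ^ 2 * g ^ 3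
          + 6 * a ^ 2 * g ^ 2 + 3 * a ^ 2 * g + a * b ^ 2 * g ^ 2 + a * b ^ 2 * g + 3 * a * b * g
          ^ 3 + 14 * a * b * g ^ 2 + 3 * a * b * g + 2 * a * g ^ 4 + 10 * a * g ^ 3 + 10 * a * g ^
          2 + 2 * a * g + 4 * b ^ 2 * g ^ 2 + 4 * b ^ 2 * g + 10 * b * g ^ 3 + 12 * b * g ^ 2 + 2
          * b * g + 4 * g ^ 4 + 8 * g ^ 3 + 4 * g ^ 2) * h3 +
      (a ^ 3 * g ^ 2 + a ^ 3 * g + 2 * a ^ 2 * b * g ^ 2 + 2 * a ^ 2 * b * g + 3 * a ^ 2 * g ^ 3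
          + 4 * a ^ 2 * g ^ 2 + a ^ 2 * g + a * b ^ 2 * g ^ 2 + a * b ^ 2 * g + 3 * a * b * g ^ 3
          + 4 * a * b * g ^ 2 + a * b * g + 2 * a * g ^ 4 + 4 * a * g ^ 3 + 2 * a * g ^ 2) * h4

lemma Tfs_mul_norm {ρ k γ : ℝ} {π : Fin 3 → Fin 3 → ℝ} (hρ : 0 < ρ) (hk : 0 < k) (hγ : 0 < γ)
    (hπ : FullStationary ρ k γ π) :
    Tfs ρ k π * (2 * γ * (1 + γ) * freeWeight ρ (k * ρ) γ + blockedWeight ρ (k * ρ) γ) =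
      (ρ + k * ρ) * (2 * γ * (1 + γ) * freeWeight ρ (k * ρ) γ) := by
  obtain ⟨-, hsum, -, e2, e3, e4, e5, e6, e7, e8, e9⟩ := hπ
  simp only [Fin.sum_univ_three] at hsum
  unfold Tfs
  have hkρ : 0 < k * ρ := mul_pos hk hρ
  set b := k * ρ with hb
  have h1 : 2 * (1 + γ) * (ρ + b + γ) * π 2 0 =
      (1 + γ) * (ρ * π 2 0 + b * π 0 1) + 2 * b * (π 2 0 + π 0 2) := by
    linear_combination 2 * (1 + γ) * e3 + (1 + γ) * e6 + 2 * e9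
  have h2 : 2 * (1 + γ) * (ρ + b + γ) * π 0 1 =
      2 * ρ * (π 1 0 + π 0 1) + (1 + γ) * (ρ * π 2 0 + b * π 0 1) := by
    linear_combination 2 * (1 + γ) * e4 + 2 * e5 + (1 + γ) * e6
  have h3 : 2 * (1 + γ) * (ρ + b + 1) * π 1 0 = 2 * (1 + γ) * ρ * π 0 0 +
      2 * γ * ρ * (π 1 0 + π 0 1) + (1 + γ) * (ρ * π 0 2 + b * π 1 0) := by
    linear_combination 2 * (1 + γ) * e2 + 2 * γ * e5 + (1 + γ) * e8
  have h4 : 2 * (1 + γ) * (ρ + b + 1) * π 0 2 = 2 * (1 + γ) * b * π 0 0 +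
      (1 + γ) * (ρ * π 0 2 + b * π 1 0) + 2 * γ * b * (π 2 0 + π 0 2) := by
    linear_combination 2 * (1 + γ) * e7 + (1 + γ) * e8 + 2 * γ * e9
  obtain ⟨hy, hu⟩ := singleton_weights hγ h1 h2 h3 h4
  obtain ⟨hx, hv⟩ := singleton_weights (a := b) (b := ρ) (x := π 0 1) (y := π 2 0) (u := π 0 2)
    (v := π 1 0) (z := π 0 0) hγ (by linear_combination h2) (by linear_combination h1)
    (by linear_combination h4) (by linear_combination h3)
  rw [idleWeight_comm] at hx hv
  have hD := idleWeight_pos hρ hkρ hγ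
  have hN := fullNorm_pos hρ hkρ hγ
  have hB : idleWeight ρ b γ * (2 * γ * (1 + γ) * (π 1 1 + π 1 2 + π 2 1 + π 2 2)) =
      π 0 0 * blockedWeight ρ b γ := by
    unfold blockedWeight
    linear_combination idleWeight ρ b γ * (2 * γ * e5 + (1 + γ) * e6 + γ * (1 + γ) * e8 +
      2 * γ * e9) + (2 * γ * ρ + (1 + γ) * b) * hy + ((1 + γ) * ρ + 2 * γ * b) * hx +
      (2 * γ * ρ + γ * (1 + γ) * b) * hu + (γ * (1 + γ) * ρ + 2 * γ * b) * hv
  have hF : idleWeight ρ b γ * (2 * γ * (1 + γ) * (1 - (π 1 1 + π 1 2 + π 2 1 + π 2 2))) =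
      π 0 0 * (2 * γ * (1 + γ) * freeWeight ρ b γ) := by
    unfold freeWeight
    linear_combination 2 * γ * (1 + γ) * (hx + hy + hu + hv) -
      idleWeight ρ b γ * 2 * γ * (1 + γ) * hsum
  have hz : π 0 0 ≠ 0 := by
    intro h
    rw [h] at hB hF
    have : idleWeight ρ b γ * (2 * γ * (1 + γ)) = 0 := by linear_combination hB + hF
    exact absurd this (by positivity)
  apply mul_left_cancel₀ hz
  linear_combination (k + 1) * ρ * (1 - (π 1 1 + π 1 2 + π 2 1 + π 2 2)) * (-hB - hF) +
    (ρ + b) * hF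

lemma Tps_mul_norm {ρ k γ : ℝ} {p : Fin 2 → Fin 3 → ℝ} (hρ : 0 < ρ) (hk : 0 < k) (hγ : 0 < γ)
    (hp : PartialStationary ρ k γ p) :
    Tps ρ k p * partialNorm ρ (k * ρ) γ = partialRate ρ (k * ρ) γ := by
  obtain ⟨-, hsum, e1, -, e3, e4, e5, e6⟩ := hp
  simp only [Fin.sum_univ_three, Fin.sum_univ_two] at hsum
  unfold Tps
  have hkρ : 0 < k * ρ := mul_pos hk hρ
  set b := k * ρ
  clear_value b
  have h11 : p 1 1 = (ρ + γ) * p 0 1 := e6.symm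
  have h10 : ρ * p 1 0 = γ * (1 + γ + ρ) * p 0 1 := by
    linear_combination (1 + γ) * h11 - e5
  have h02' : ρ * (ρ + b + 2) * p 0 2 = b * ((2 + ρ + b) * p 1 0 + 2 * γ * p 0 1) := by
    linear_combination (ρ + b) * (2 * e4 + e3) + 2 * b * e1
  have h02 : ρ ^ 2 * (ρ + b + 2) * p 0 2 = p 0 1 *
      (b * ((2 + ρ + b) * (γ * (1 + γ + ρ)) + 2 * γ * ρ)) := by
    linear_combination ρ * h02' + b * (2 + ρ + b) * h10
  have h00 : ρ ^ 2 * (ρ + b + 2) * p 0 0 = p 0 1 *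
      (2 * ρ ^ 2 * γ + ρ * b * γ + ρ * γ ^ 2 + 5 * ρ * γ + b * γ ^ 2 + b * γ + 2 * γ ^ 2 + 2 * γ) := by
    apply mul_left_cancel₀ (show ρ + b ≠ 0 by positivity)
    linear_combination ρ ^ 2 * (ρ + b + 2) * e1 + h02 + ρ * (ρ + b + 2) * h10
  have h12 : 2 * (ρ ^ 2 * (ρ + b + 2) * p 1 2) = p 0 1 *
      (ρ * (b * ((2 + ρ + b) * (γ * (1 + γ + ρ)) + 2 * γ * ρ)) +
        b * (ρ * (ρ + b + 2) * (γ * (1 + γ + ρ)))) := by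
    linear_combination ρ ^ 2 * (ρ + b + 2) * e3 + ρ * h02 + b * ρ * (ρ + b + 2) * h10
  have hN := partialNorm_pos hρ hkρ hγ
  have hnorm : ρ ^ 2 * (ρ + b + 2) = p 0 1 * partialNorm ρ b γ := by
    unfold partialNorm
    linear_combination -ρ ^ 2 * (ρ + b + 2) * hsum + h00 + h02 + h12 / 2 +
      ρ * (ρ + b + 2) * h10 + ρ ^ 2 * (ρ + b + 2) * h11
  have hx : p 0 1 ≠ 0 := by
    intro h
    rw [h, zero_mul] at hnorm
    exact absurd hnorm (by positivity)
  apply mul_left_cancel₀ hx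
  unfold partialRate
  linear_combination
    -(ρ * (1 - p 1 1 - p 1 2) + b * (1 - p 1 1 - p 1 2 - p 0 1 - p 0 2)) * hnorm -
      ρ ^ 2 * (ρ + b + 2) * (ρ + b) * hsum + (ρ + b) * h00 + ρ * h02 +
      ρ * (ρ + b + 2) * (ρ + b) * h10

/-- The difference of the throughputs of the full and of the partial flexibility systems. -/
lemma throughput_sub_mul {ρ k γ : ℝ} {π : Fin 3 → Fin 3 → ℝ} {p : Fin 2 → Fin 3 → ℝ}
    (hρ : 0 < ρ) (hk : 0 < k) (hγ : 0 < γ) (hπ : FullStationary ρ k γ π)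
    (hp : PartialStationary ρ k γ p) :
    (Tfs ρ k π - Tps ρ k p) *
        ((2 * γ * (1 + γ) * freeWeight ρ (k * ρ) γ + blockedWeight ρ (k * ρ) γ) *
          partialNorm ρ (k * ρ) γ) =
      2 * (k * ρ) * (1 + γ) * crossingPoly ρ (k * ρ) γ := by
  have hf := Tfs_mul_norm hρ hk hγ hπ
  have hq := Tps_mul_norm hρ hk hγ hp
  have key : ∀ b : ℝ, (ρ + b) * (2 * γ * (1 + γ) * freeWeight ρ b γ) * partialNorm ρ b γ -
      partialRate ρ b γ * (2 * γ * (1 + γ) * freeWeight ρ b γ + blockedWeight ρ b γ) =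
      2 * b * (1 + γ) * crossingPoly ρ b γ := by
    intro b
    simp only [freeWeight, blockedWeight, idleWeight, overflowWeight, dedicatedWeight, partialNorm,
      partialRate, crossingPoly, crossingCoeffZero, crossingCoeffOne, crossingCoeffTwo,
      crossingCoeffThree, crossingCoeffFour, crossingCoeffFive, crossingCoeffSix,
      crossingCoeffSeven]
    ring
  linear_combination partialNorm ρ (k * ρ) γ * hf -
    (2 * γ * (1 + γ) * freeWeight ρ (k * ρ) γ + blockedWeight ρ (k * ρ) γ) * hq + key (k * ρ)

/-- `crossingPoly a b g / g ^ 2` is increasing in `g`. -/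
lemma crossingPoly_mul_sq_lt {a b g g' : ℝ} (ha : 0 < a) (hb : 0 < b) (hg : 0 < g) (hgg : g < g') :
    crossingPoly a b g * g' ^ 2 < crossingPoly a b g' * g ^ 2 := by
  have h0 : 0 < crossingCoeffZero a b := by unfold crossingCoeffZero; positivity
  have h1 : 0 < crossingCoeffOne a b := by unfold crossingCoeffOne; positivity
  have h3 : 0 < crossingCoeffThree a b := by unfold crossingCoeffThree; positivity
  have h4 : 0 < crossingCoeffFour a b := by unfold crossingCoeffFour; positivity
  have h5 : 0 < crossingCoeffFive a b := by unfold crossingCoeffFive; positivity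
  have h6 : 0 < crossingCoeffSix a b := by unfold crossingCoeffSix; positivity
  have h7 : 0 < crossingCoeffSeven a b := by unfold crossingCoeffSeven; positivity
  obtain ⟨d, rfl⟩ : ∃ d, g' = g + d := ⟨g' - g, by ring⟩
  have hd : 0 < d := by linarith
  unfold crossingPoly
  generalize crossingCoeffZero a b = c0, crossingCoeffOne a b = c1, crossingCoeffTwo a b = c2,
    crossingCoeffThree a b = c3, crossingCoeffFour a b = c4, crossingCoeffFive a b = c5,
    crossingCoeffSix a b = c6, crossingCoeffSeven a b = c7 at *
  have key : 0 < d * (c0 * (2 * g + d) + c1 * g * (g + d) + g ^ 2 * (g + d) ^ 2 *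
      (c3 + c4 * (2 * g + d) + c5 * (3 * g ^ 2 + 3 * g * d + d ^ 2) +
        c6 * (4 * g ^ 3 + 6 * g ^ 2 * d + 4 * g * d ^ 2 + d ^ 3) +
        c7 * (5 * g ^ 4 + 10 * g ^ 3 * d + 10 * g ^ 2 * d ^ 2 + 5 * g * d ^ 3 + d ^ 4))) := by
    positivity
  linear_combination key

/-- The crossing polynomial is negative at the point where the partial flexibility system and the
independent system have equal throughput. -/
lemma crossingPoly_div_neg {a b : ℝ} (hb : 0 < b) (hab : b < a) :
    crossingPoly a b (b / (1 + b)) < 0 := by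
  have ha : 0 < a := hb.trans hab
  have hclear : crossingPoly a b (b / (1 + b)) * (1 + b) ^ 7 =
      -crossingCoeffZero a b * (1 + b) ^ 7 - crossingCoeffOne a b * b * (1 + b) ^ 6 +
        crossingCoeffTwo a b * b ^ 2 * (1 + b) ^ 5 + crossingCoeffThree a b * b ^ 3 * (1 + b) ^ 4 +
        crossingCoeffFour a b * b ^ 4 * (1 + b) ^ 3 + crossingCoeffFive a b * b ^ 5 * (1 + b) ^ 2 +
        crossingCoeffSix a b * b ^ 6 * (1 + b) + crossingCoeffSeven a b * b ^ 7 := by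
    unfold crossingPoly
    field_simp
  have key : crossingPoly a b (b / (1 + b)) * (1 + b) ^ 7 = (1 + b) * (b - a) *
(2 * a ^ 7 * b ^ 5 + 9 * a ^ 7 * b ^ 4 + 16 * a ^ 7 * b ^ 3 + 14 * a ^ 7 * b ^ 2 + 6 * a ^ 7
        * b + a ^ 7 + 12 * a ^ 6 * b ^ 6 + 66 * a ^ 6 * b ^ 5 + 146 * a ^ 6 * b ^ 4 + 166 * a ^ 6
        * b ^ 3 + 102 * a ^ 6 * b ^ 2 + 32 * a ^ 6 * b + 4 * a ^ 6 + 30 * a ^ 5 * b ^ 7 + 205 * a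
        ^ 5 * b ^ 6 + 543 * a ^ 5 * b ^ 5 + 738 * a ^ 5 * b ^ 4 + 558 * a ^ 5 * b ^ 3 + 233 * a ^
        5 * b ^ 2 + 49 * a ^ 5 * b + 4 * a ^ 5 + 40 * a ^ 4 * b ^ 8 + 344 * a ^ 4 * b ^ 7 + 1106 *
        a ^ 4 * b ^ 6 + 1768 * a ^ 4 * b ^ 5 + 1555 * a ^ 4 * b ^ 4 + 765 * a ^ 4 * b ^ 3 + 196 *
        a ^ 4 * b ^ 2 + 20 * a ^ 4 * b + 30 * a ^ 3 * b ^ 9 + 331 * a ^ 3 * b ^ 8 + 1328 * a ^ 3 *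
        b ^ 7 + 2555 * a ^ 3 * b ^ 6 + 2622 * a ^ 3 * b ^ 5 + 1489 * a ^ 3 * b ^ 4 + 457 * a ^ 3 *
        b ^ 3 + 68 * a ^ 3 * b ^ 2 + 4 * a ^ 3 * b + 12 * a ^ 2 * b ^ 10 + 178 * a ^ 2 * b ^ 9 +
        920 * a ^ 2 * b ^ 8 + 2225 * a ^ 2 * b ^ 7 + 2771 * a ^ 2 * b ^ 6 + 1855 * a ^ 2 * b ^ 5 +
        667 * a ^ 2 * b ^ 4 + 120 * a ^ 2 * b ^ 3 + 8 * a ^ 2 * b ^ 2 + 2 * a * b ^ 11 + 47 * a *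
        b ^ 10 + 329 * a * b ^ 9 + 1045 * a * b ^ 8 + 1692 * a * b ^ 7 + 1423 * a * b ^ 6 + 608 *
        a * b ^ 5 + 120 * a * b ^ 4 + 8 * a * b ^ 3 + 4 * b ^ 11 + 44 * b ^ 10 + 193 * b ^ 9 + 430
        * b ^ 8 + 514 * b ^ 7 + 323 * b ^ 6 + 100 * b ^ 5 + 12 * b ^ 4) := by
    rw [hclear, crossingCoeffZero, crossingCoeffOne, crossingCoeffTwo, crossingCoeffThree,
      crossingCoeffFour, crossingCoeffFive, crossingCoeffSix, crossingCoeffSeven]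
    ring
  have hneg : crossingPoly a b (b / (1 + b)) * (1 + b) ^ 7 < 0 := by
    rw [key]
    exact mul_neg_of_neg_of_pos (mul_neg_of_pos_of_neg (by positivity) (by linarith))
      (by positivity)
  exact neg_of_mul_neg_left hneg (by positivity)

lemma Tis_lt_Tps {ρ k γ : ℝ} {p : Fin 2 → Fin 3 → ℝ} (hρ : 0 < ρ) (hk : 0 < k) (hγ : 0 < γ)
    (hp : PartialStationary ρ k γ p) (h : k * ρ / (1 + k * ρ) < γ) : Tis ρ k < Tps ρ k p := by
  have hq := Tps_mul_norm hρ hk hγ hp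
  have hkρ : 0 < k * ρ := mul_pos hk hρ
  unfold Tis
  set b := k * ρ
  clear_value b
  have hN := partialNorm_pos hρ hkρ hγ
  rw [div_lt_iff₀ (by positivity)] at h
  rw [← sub_pos]
  have key : (Tps ρ k p - (ρ / (ρ + 1) + b / (b + 1))) *
      (partialNorm ρ b γ * ((ρ + 1) * (b + 1))) =
      ρ ^ 2 * (ρ + 1) * (ρ + b + 2) * (1 + ρ + γ) * (γ * (1 + b) - b) := by
    have hT : (ρ / (ρ + 1) + b / (b + 1)) * ((ρ + 1) * (b + 1)) =
        ρ * (b + 1) + b * (ρ + 1) := by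
      field_simp
    have hpoly : partialRate ρ b γ * ((ρ + 1) * (b + 1)) -
        partialNorm ρ b γ * (ρ * (b + 1) + b * (ρ + 1)) =
        ρ ^ 2 * (ρ + 1) * (ρ + b + 2) * (1 + ρ + γ) * (γ * (1 + b) - b) := by
      unfold partialNorm partialRate
      ring
    linear_combination (ρ + 1) * (b + 1) * hq - partialNorm ρ b γ * hT + hpoly
  refine pos_of_mul_pos_left ?_ (show 0 ≤ partialNorm ρ b γ * ((ρ + 1) * (b + 1)) by positivity)
  rw [key]
  have := sub_pos.2 h
  positivity

/-- for `γ ∈ (γ^r, 1)` one has `T_is < T_ps < T_fs`; the full flexibility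
system is optimal on this range. -/
theorem stmt_18 (ρ k : ℝ) (hρ : 0 < ρ) (hk : k ∈ Set.Ioo (0:ℝ) 1)
    (γr : ℝ) (hγr : γr ∈ Set.Ioo (0:ℝ) 1)
    (hr : ∃ (πr : Fin 3 → Fin 3 → ℝ) (pr : Fin 2 → Fin 3 → ℝ),
      FullStationary ρ k γr πr ∧ PartialStationary ρ k γr pr ∧ Tfs ρ k πr = Tps ρ k pr)
    (γ : ℝ) (hγ : γr < γ) (hγ' : γ < 1)
    (π : Fin 3 → Fin 3 → ℝ) (p : Fin 2 → Fin 3 → ℝ)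
    (hπ : FullStationary ρ k γ π) (hp : PartialStationary ρ k γ p) :
    Tis ρ k < Tps ρ k p ∧ Tps ρ k p < Tfs ρ k π := by
  obtain ⟨πr, pr, hπr, hpr, hr⟩ := hr
  obtain ⟨hk0, hk1⟩ := hk
  have hγr0 := hγr.1
  have hγ0 : 0 < γ := hγr0.trans hγ
  have hkρ : 0 < k * ρ := mul_pos hk0 hρ
  have hlt : k * ρ < ρ := by nlinarith
  have hzero : crossingPoly ρ (k * ρ) γr = 0 := by
    have h := throughput_sub_mul hρ hk0 hγr0 hπr hpr
    rw [hr, sub_self, zero_mul, eq_comm, mul_eq_zero] at h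
    exact h.resolve_left (by positivity)
  have hpos : 0 < crossingPoly ρ (k * ρ) γ := by
    have h := crossingPoly_mul_sq_lt hρ hkρ hγr0 hγ
    rw [hzero, zero_mul] at h
    exact pos_of_mul_pos_left h (sq_nonneg γr)
  constructor
  · refine Tis_lt_Tps hρ hk0 hγ0 hp (lt_trans ?_ hγ)
    have hneg := crossingPoly_div_neg hkρ hlt
    by_contra! hle
    rcases hle.eq_or_lt with heq | hle
    · rw [← heq, hzero] at hneg
      exact hneg.false
    · have h := crossingPoly_mul_sq_lt hρ hkρ hγr0 hle
      rw [hzero, zero_mul] at h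
      exact (pos_of_mul_pos_left h (sq_nonneg γr)).not_gt hneg
  · have h := throughput_sub_mul hρ hk0 hγ0 hπ hp
    have hN := mul_pos (fullNorm_pos hρ hkρ hγ0) (partialNorm_pos hρ hkρ hγ0)
    rw [← sub_pos]
    refine pos_of_mul_pos_left ?_ hN.le
    rw [h]
    positivity
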